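/- Let A ⊃ B be a purely predicate formula that is classically derivable but not derivable in LJ+, let C be a propositional formula derivable in LJ+, and let D be a propositional formula not derivable in LJ+. Then neither (A & C) ⊃ B nor A ⊃ (B ∨ D) is derivable in LJ+. -/

import Mathlib

/-! Syntax of first-order formulas. Atoms are either propositional symbols
(arity-0) or predicate symbols of arity ≥ 1 applied to variables.
There are no function symbols or object constants: terms are variables (ℕ). -/

inductive Formula : Type
  | prop : ℕ → Formula                      -- propositional symbol
  | pred : ℕ → ℕ → List ℕ → Formula         -- predicate symbol (arity ≥ 1) applied to variables
  | top : Formula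
  | bot : Formula
  | and : Formula → Formula → Formula
  | or : Formula → Formula → Formula
  | imp : Formula → Formula → Formula
  | neg : Formula → Formula
  | all : ℕ → Formula → Formula             -- ∀x A
  | ex : ℕ → Formula → Formula              -- ∃x A
  deriving DecidableEq

namespace Formula

/-- Free variables of a formula. -/
def fv : Formula → Finset ℕ
  | prop _ => ∅
  | pred _ x xs => insert x xs.toFinset
  | top => ∅
  | bot => ∅
  | and A B => fv A ∪ fv B
  | or A B => fv A ∪ fv B
  | imp A B => fv A ∪ fv B
  | neg A => fv A
  | all x A => (fv A).erase x
  | ex x A => (fv A).erase x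

/-- All variables occurring in a formula (free or bound, including binders). -/
def vars : Formula → Finset ℕ
  | prop _ => ∅
  | pred _ x xs => insert x xs.toFinset
  | top => ∅
  | bot => ∅
  | and A B => vars A ∪ vars B
  | or A B => vars A ∪ vars B
  | imp A B => vars A ∪ vars B
  | neg A => vars A
  | all x A => insert x (vars A)
  | ex x A => insert x (vars A)

/-- Binder variables of a formula. -/
def bv : Formula → Finset ℕ
  | prop _ => ∅
  | pred _ _ _ => ∅
  | top => ∅
  | bot => ∅
  | and A B => bv A ∪ bv B
  | or A B => bv A ∪ bv B
  | imp A B => bv A ∪ bv B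
  | neg A => bv A
  | all x A => insert x (bv A)
  | ex x A => insert x (bv A)

/-- `rename a b F` replaces the free occurrences of variable `a` in `F` by variable `b`.
`F.rename a b` plays the role of "F(b)" when `F` is "F(a)". -/
def rename (a b : ℕ) : Formula → Formula
  | prop n => prop n
  | pred n x xs =>
      pred n (if x = a then b else x) (xs.map fun y => if y = a then b else y)
  | top => top
  | bot => bot
  | and A B => and (rename a b A) (rename a b B)
  | or A B => or (rename a b A) (rename a b B)
  | imp A B => imp (rename a b A) (rename a b B)
  | neg A => neg (rename a b A)
  | all x A => if x = a then all x A else all x (rename a b A)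
  | ex x A => if x = a then ex x A else ex x (rename a b A)

/-- A formula is propositional if it is built from propositional symbols (and ⊤, ⊥)
by the propositional connectives only. -/
def Propositional : Formula → Prop
  | prop _ => True
  | pred _ _ _ => False
  | top => True
  | bot => True
  | and A B => Propositional A ∧ Propositional B
  | or A B => Propositional A ∧ Propositional B
  | imp A B => Propositional A ∧ Propositional B
  | neg A => Propositional A
  | all _ _ => False
  | ex _ _ => False

/-- A formula is purely predicate if all its atoms are built from predicate symbols
of arity > 0 (it contains no propositional symbols). -/
def PurelyPredicate : Formula → Prop
  | prop _ => False
  | pred _ _ _ => True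
  | top => True
  | bot => True
  | and A B => PurelyPredicate A ∧ PurelyPredicate B
  | or A B => PurelyPredicate A ∧ PurelyPredicate B
  | imp A B => PurelyPredicate A ∧ PurelyPredicate B
  | neg A => PurelyPredicate A
  | all _ A => PurelyPredicate A
  | ex _ A => PurelyPredicate A

/-- Truth-table evaluation of a propositional formula under assignment `v`. -/
def evalP (v : ℕ → Bool) : Formula → Bool
  | prop n => v n
  | pred _ _ _ => false
  | top => true
  | bot => false
  | and A B => evalP v A && evalP v B
  | or A B => evalP v A || evalP v B
  | imp A B => !evalP v A || evalP v B
  | neg A => !evalP v A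
  | all _ _ => false
  | ex _ _ => false

/-- A (propositional) formula is classically valid / derivable in classical
propositional logic if it is true under every truth-value assignment. -/
def ClassicallyValid (A : Formula) : Prop := ∀ v : ℕ → Bool, evalP v A = true

/-- `substProp R C A` replaces all occurrences of the propositional symbol `R`
in `A` by the formula `C` (written A{R|C} in the paper). -/
def substProp (R : ℕ) (C : Formula) : Formula → Formula
  | prop n => if n = R then C else prop n
  | pred n x xs => pred n x xs
  | top => top
  | bot => bot
  | and A B => and (substProp R C A) (substProp R C B)
  | or A B => or (substProp R C A) (substProp R C B)
  | imp A B => imp (substProp R C A) (substProp R C B)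
  | neg A => neg (substProp R C A)
  | all x A => all x (substProp R C A)
  | ex x A => ex x (substProp R C A)

/-- `polProps b F` is the set of propositional symbols having an occurrence of
polarity `b` in `F` (`true` = positive, `false` = negative); `F` itself is a
positive occurrence, ∨ & quantifiers preserve polarity, ¬ flips it, and
`A ⊃ B` flips the polarity of `A` and preserves that of `B`. -/
def polProps : Bool → Formula → Finset ℕ
  | b, prop n => if b then {n} else ∅
  | _, pred _ _ _ => ∅
  | _, top => ∅
  | _, bot => ∅
  | b, and A B => polProps b A ∪ polProps b B
  | b, or A B => polProps b A ∪ polProps b B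
  | b, imp A B => polProps (!b) A ∪ polProps b B
  | b, neg A => polProps (!b) A
  | b, all _ A => polProps b A
  | b, ex _ A => polProps b A

/-- The propositional symbols occurring in a formula. -/
def propSyms (F : Formula) : Finset ℕ := polProps true F ∪ polProps false F

/-- A formula is unipolar if the occurrences of every propositional symbol in it
are either all positive or all negative. -/
def Unipolar (F : Formula) : Prop :=
  ∀ n : ℕ, ¬ (n ∈ polProps true F ∧ n ∈ polProps false F)

end Formula

/-- A sequent Γ ⊢ Λ: the antecedent is a finite sequence of formulas and the
succedent contains at most one formula. -/
abbrev Sequent := List Formula × Option Formula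

/-- Free variables of a list of formulas. -/
def fvList (Γ : List Formula) : Finset ℕ := Γ.foldr (fun A s => A.fv ∪ s) ∅

/-- Free variables of an optional succedent formula. -/
def fvOpt : Option Formula → Finset ℕ
  | none => ∅
  | some A => A.fv

/-- Inference rules (conclusion, list of premises) of Gentzen-style sequent calculi.
The flag `cut` enables the cut rule, the flag `neut` enables the neutralization
rule (restricted to propositional formulas `N`), and `lem` determines the class of
formulas `A` for which the axiom `⊢ A ∨ ¬A` is available. -/
inductive Rule (cut neut : Bool) (lem : Formula → Prop) : Sequent → List Sequent → Prop
  | ax (A : Formula) : Rule cut neut lem ([A], some A) []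
  | topR : Rule cut neut lem ([], some .top) []
  | botL : Rule cut neut lem ([.bot], none) []
  | thinL (A : Formula) (Γ : List Formula) (Λ : Option Formula) :
      Rule cut neut lem (A :: Γ, Λ) [(Γ, Λ)]
  | thinR (A : Formula) (Γ : List Formula) :
      Rule cut neut lem (Γ, some A) [(Γ, none)]
  | contr (A : Formula) (Γ : List Formula) (Λ : Option Formula) :
      Rule cut neut lem (A :: Γ, Λ) [(A :: A :: Γ, Λ)]
  | exch (Δ Γ : List Formula) (A B : Formula) (Λ : Option Formula) :
      Rule cut neut lem (Δ ++ B :: A :: Γ, Λ) [(Δ ++ A :: B :: Γ, Λ)]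
  | cut' (Γ Δ : List Formula) (C : Formula) (Λ : Option Formula) (hc : cut = true) :
      Rule cut neut lem (Γ ++ Δ, Λ) [(Γ, some C), (C :: Δ, Λ)]
  | andR (Γ : List Formula) (A B : Formula) :
      Rule cut neut lem (Γ, some (A.and B)) [(Γ, some A), (Γ, some B)]
  | andL1 (A B : Formula) (Γ : List Formula) (Λ : Option Formula) :
      Rule cut neut lem (A.and B :: Γ, Λ) [(A :: Γ, Λ)]
  | andL2 (A B : Formula) (Γ : List Formula) (Λ : Option Formula) :
      Rule cut neut lem (A.and B :: Γ, Λ) [(B :: Γ, Λ)]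
  | orL (A B : Formula) (Γ : List Formula) (Λ : Option Formula) :
      Rule cut neut lem (A.or B :: Γ, Λ) [(A :: Γ, Λ), (B :: Γ, Λ)]
  | orR1 (Γ : List Formula) (A B : Formula) :
      Rule cut neut lem (Γ, some (A.or B)) [(Γ, some A)]
  | orR2 (Γ : List Formula) (A B : Formula) :
      Rule cut neut lem (Γ, some (A.or B)) [(Γ, some B)]
  | negR (A : Formula) (Γ : List Formula) :
      Rule cut neut lem (Γ, some A.neg) [(A :: Γ, none)]
  | negL (A : Formula) (Γ : List Formula) :
      Rule cut neut lem (A.neg :: Γ, none) [(Γ, some A)]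
  | impR (A B : Formula) (Γ : List Formula) :
      Rule cut neut lem (Γ, some (A.imp B)) [(A :: Γ, some B)]
  | impL (A B : Formula) (Γ Δ : List Formula) (Λ : Option Formula) :
      Rule cut neut lem (A.imp B :: (Γ ++ Δ), Λ) [(Γ, some A), (B :: Δ, Λ)]
  | allR (Γ : List Formula) (x a : ℕ) (G : Formula)
      (ha : a ∉ fvList Γ ∪ (Formula.all x G).fv) (hv : a ∉ G.vars) :
      Rule cut neut lem (Γ, some (.all x G)) [(Γ, some (G.rename x a))]
  | allL (x : ℕ) (G : Formula) (a : ℕ) (Γ : List Formula) (Λ : Option Formula)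
      (hc : a = x ∨ a ∉ G.bv) :
      Rule cut neut lem (.all x G :: Γ, Λ) [(G.rename x a :: Γ, Λ)]
  | exR (Γ : List Formula) (x : ℕ) (G : Formula) (a : ℕ)
      (hc : a = x ∨ a ∉ G.bv) :
      Rule cut neut lem (Γ, some (.ex x G)) [(Γ, some (G.rename x a))]
  | exL (x : ℕ) (G : Formula) (a : ℕ) (Γ : List Formula) (Λ : Option Formula)
      (ha : a ∉ (fvList Γ ∪ (Formula.ex x G).fv) ∪ fvOpt Λ) (hv : a ∉ G.vars) :
      Rule cut neut lem (.ex x G :: Γ, Λ) [(G.rename x a :: Γ, Λ)]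
  | neut' (N : Formula) (Γ : List Formula) (Λ : Option Formula)
      (hn : neut = true) (hN : N.Propositional) :
      Rule cut neut lem (Γ, Λ) [(N :: Γ, Λ), (N.neg :: Γ, Λ)]
  | lemAx (A : Formula) (h : lem A) :
      Rule cut neut lem ([], some (A.or A.neg)) []

/-- Derivability from a set of rules. -/
inductive Derives (R : Sequent → List Sequent → Prop) : Sequent → Prop
  | step {s : Sequent} {ps : List Sequent} :
      R s ps → (∀ p ∈ ps, Derives R p) → Derives R s

/-- No additional excluded-middle axioms. -/
def NoLem : Formula → Prop := fun _ => False

/-- LJ: Gentzen's intuitionistic sequent calculus. -/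
def LJ : Sequent → Prop := Derives (Rule true false NoLem)

/-- LJ+: LJ extended with the neutralization rule. -/
def LJPlus : Sequent → Prop := Derives (Rule true true NoLem)

/-- Cut-free LJ+. -/
def LJPlusCF : Sequent → Prop := Derives (Rule false true NoLem)

/-- LJ extended with the axiom schema ⊢ A ∨ ¬A for every propositional symbol A. -/
def LJLemPropAtoms : Sequent → Prop :=
  Derives (Rule true false (fun A => ∃ n : ℕ, A = Formula.prop n))

/-- LK: Gentzen's classical sequent calculus, presented equivalently as
LJ plus the axiom schema ⊢ A ∨ ¬A for arbitrary formulas A. -/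
def LK : Sequent → Prop := Derives (Rule true false (fun _ => True))

/-- A formula is a theorem of LJ+ if the sequent ⊢ F is derivable. -/
def LJPlusThm (F : Formula) : Prop := LJPlus ([], some F)

def LJThm (F : Formula) : Prop := LJ ([], some F)

def LKThm (F : Formula) : Prop := LK ([], some F)

/-- Intuitionistic Kripke structures: a partially ordered set of nodes with
monotone nonempty domains and monotone valuations for propositional symbols
and for predicate symbols. -/
structure Kripke where
  W : Type
  U : Type
  le : W → W → Prop
  le_refl : ∀ w, le w w
  le_trans : ∀ u v w, le u v → le v w → le u w
  le_antisymm : ∀ u v, le u v → le v u → u = v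
  D : W → Set U
  D_ne : ∀ w, (D w).Nonempty
  D_mono : ∀ {w w'}, le w w' → D w ⊆ D w'
  TP : W → ℕ → Prop
  TQ : W → ℕ → List U → Prop
  TP_mono : ∀ {w w'}, le w w' → ∀ n, TP w n → TP w' n
  TQ_mono : ∀ {w w'}, le w w' → ∀ n ds, TQ w n ds → TQ w' n ds

/-- A constrained Kripke structure: for all nodes k ≤ k' and every propositional
symbol Q, Q is in the valuation of k if and only if it is in the valuation of k'. -/
def Kripke.Constrained (K : Kripke) : Prop :=
  ∀ {w w' : K.W}, K.le w w' → ∀ n : ℕ, (K.TP w n ↔ K.TP w' n)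

/-- The standard intuitionistic forcing relation (with an assignment σ of
domain elements to variables). -/
def Kripke.forces (K : Kripke) : K.W → (ℕ → K.U) → Formula → Prop
  | w, _, .prop n => K.TP w n
  | w, σ, .pred n x xs => K.TQ w n ((x :: xs).map σ)
  | _, _, .top => True
  | _, _, .bot => False
  | w, σ, .and A B => K.forces w σ A ∧ K.forces w σ B
  | w, σ, .or A B => K.forces w σ A ∨ K.forces w σ B
  | w, σ, .imp A B => ∀ w', K.le w w' → K.forces w' σ A → K.forces w' σ B
  | w, σ, .neg A => ∀ w', K.le w w' → ¬ K.forces w' σ A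
  | w, σ, .all x A => ∀ w', K.le w w' → ∀ d ∈ K.D w', K.forces w' (Function.update σ x d) A
  | w, σ, .ex x A => ∃ d ∈ K.D w, K.forces w (Function.update σ x d) A

/-- Validity of a sequent with respect to constrained Kripke structures:
at every node of every constrained Kripke structure (under every assignment into
the node's domain), either some antecedent formula is not forced, or the
succedent is nonempty and its formula is forced. -/
def SeqValid (s : Sequent) : Prop :=
  ∀ K : Kripke, K.Constrained → ∀ w : K.W, ∀ σ : ℕ → K.U, (∀ n, σ n ∈ K.D w) →
    (∃ A ∈ s.1, ¬ K.forces w σ A) ∨ (∃ A, s.2 = some A ∧ K.forces w σ A)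

namespace Formula

/-- Simultaneous replacement of every propositional symbol `n` by the formula `s n`. -/
def bindProps (s : ℕ → Formula) : Formula → Formula
  | prop n => s n
  | pred n x xs => pred n x xs
  | top => top
  | bot => bot
  | and A B => and (bindProps s A) (bindProps s B)
  | or A B => or (bindProps s A) (bindProps s B)
  | imp A B => imp (bindProps s A) (bindProps s B)
  | neg A => neg (bindProps s A)
  | all x A => all x (bindProps s A)
  | ex x A => ex x (bindProps s A)

/-- The propositional constant denoting a truth value. -/
def truthConst : Bool → Formula
  | true => top
  | false => bot

theorem bindProps_prop (F : Formula) : F.bindProps prop = F := by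
  induction F <;> simp_all [bindProps]

theorem PurelyPredicate.bindProps_eq {F : Formula} (s : ℕ → Formula) (h : F.PurelyPredicate) :
    F.bindProps s = F := by
  induction F <;> simp_all [bindProps, PurelyPredicate]

theorem Propositional.bindProps {F : Formula} {s : ℕ → Formula} (hs : ∀ n, (s n).Propositional)
    (h : F.Propositional) : (F.bindProps s).Propositional := by
  induction F <;> simp_all [Formula.bindProps, Propositional]

theorem propositional_truthConst (b : Bool) : (truthConst b).Propositional := by
  cases b <;> trivial

section TruthConst

variable (v : ℕ → Bool)

theorem fv_bindProps_truthConst (F : Formula) :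
    (F.bindProps fun n => truthConst (v n)).fv = F.fv := by
  induction F with
  | prop n => cases h : v n <;> simp [bindProps, truthConst, fv, h]
  | _ => simp_all [bindProps, fv]

theorem vars_bindProps_truthConst (F : Formula) :
    (F.bindProps fun n => truthConst (v n)).vars = F.vars := by
  induction F with
  | prop n => cases h : v n <;> simp [bindProps, truthConst, vars, h]
  | _ => simp_all [bindProps, vars]

theorem bv_bindProps_truthConst (F : Formula) :
    (F.bindProps fun n => truthConst (v n)).bv = F.bv := by
  induction F with
  | prop n => cases h : v n <;> simp [bindProps, truthConst, bv, h]
  | _ => simp_all [bindProps, bv]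

theorem bindProps_truthConst_rename (a b : ℕ) (F : Formula) :
    (F.rename a b).bindProps (fun n => truthConst (v n)) =
      (F.bindProps fun n => truthConst (v n)).rename a b := by
  induction F with
  | prop n => cases h : v n <;> simp [bindProps, truthConst, rename, h]
  | all x A ih => by_cases h : x = a <;> simp [bindProps, rename, h, ih]
  | ex x A ih => by_cases h : x = a <;> simp [bindProps, rename, h, ih]
  | _ => simp_all [bindProps, rename]

end TruthConst

theorem propSyms_neg (A : Formula) : (neg A).propSyms = A.propSyms :=
  Finset.union_comm _ _

theorem propSyms_and (A B : Formula) : (and A B).propSyms = A.propSyms ∪ B.propSyms := by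
  ext n
  simp only [propSyms, polProps, Finset.mem_union]
  tauto

theorem propSyms_or (A B : Formula) : (or A B).propSyms = A.propSyms ∪ B.propSyms := by
  ext n
  simp only [propSyms, polProps, Finset.mem_union]
  tauto

theorem propSyms_imp (A B : Formula) : (imp A B).propSyms = A.propSyms ∪ B.propSyms := by
  ext n
  simp only [propSyms, polProps, Finset.mem_union, Bool.not_true, Bool.not_false]
  tauto

/-- The literal over the propositional symbol `n` with truth value `b`. -/
def literal (n : ℕ) : Bool → Formula
  | true => prop n
  | false => neg (prop n)

end Formula

theorem fvList_map_bindProps_truthConst (v : ℕ → Bool) (Γ : List Formula) :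
    fvList (Γ.map (Formula.bindProps fun n => Formula.truthConst (v n))) = fvList Γ := by
  induction Γ with
  | nil => rfl
  | cons A Γ ih =>
    simp only [fvList, List.map_cons, List.foldr_cons] at ih ⊢
    rw [ih, Formula.fv_bindProps_truthConst]

theorem fvOpt_map_bindProps_truthConst (v : ℕ → Bool) (Λ : Option Formula) :
    fvOpt (Λ.map (Formula.bindProps fun n => Formula.truthConst (v n))) = fvOpt Λ := by
  cases Λ <;> simp [fvOpt, Formula.fv_bindProps_truthConst]

namespace LJPlus

open Formula

/-- LJ+ is closed under replacing propositional symbols by propositional constants. -/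
theorem bindProps_truthConst (v : ℕ → Bool) {s : Sequent} (h : LJPlus s) :
    LJPlus (s.1.map (bindProps fun n => truthConst (v n)),
      s.2.map (bindProps fun n => truthConst (v n))) := by
  induction h with
  | @step s ps hr _ ih =>
    refine .step (ps := ps.map fun p => (p.1.map (bindProps fun n => truthConst (v n)),
      p.2.map (bindProps fun n => truthConst (v n)))) ?_ ?_
    · clear ih
      cases hr with
      | allR Γ x a G ha hv =>
        simp only [List.map_cons, List.map_nil, Option.map_some, bindProps_truthConst_rename]
        refine .allR _ _ _ _ ?_ (by rwa [vars_bindProps_truthConst])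
        rw [fvList_map_bindProps_truthConst]
        simpa [fv, fv_bindProps_truthConst] using ha
      | allL x G a Γ Λ hc =>
        simp only [List.map_cons, List.map_nil, bindProps_truthConst_rename]
        exact .allL _ _ _ _ _ (by rwa [bv_bindProps_truthConst])
      | exR Γ x G a hc =>
        simp only [List.map_cons, List.map_nil, Option.map_some, bindProps_truthConst_rename]
        exact .exR _ _ _ _ (by rwa [bv_bindProps_truthConst])
      | exL x G a Γ Λ ha hv =>
        simp only [List.map_cons, List.map_nil, bindProps_truthConst_rename]
        refine .exL _ _ _ _ _ ?_ (by rwa [vars_bindProps_truthConst])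
        rw [fvList_map_bindProps_truthConst, fvOpt_map_bindProps_truthConst]
        simpa [fv, fv_bindProps_truthConst] using ha
      | neut' N Γ Λ hn hN =>
        exact .neut' _ _ _ hn (hN.bindProps fun n => propositional_truthConst _)
      | lemAx A h => exact h.elim
      | cut' Γ Δ C Λ hc =>
        simp only [List.map_append, List.map_cons, List.map_nil, Option.map_some]
        exact .cut' _ _ _ _ hc
      | impL A B Γ Δ Λ =>
        simp only [List.map_append, List.map_cons, List.map_nil, Option.map_some]
        exact .impL _ _ _ _ _
      | exch Δ Γ A B Λ =>
        simp only [List.map_append, List.map_cons, List.map_nil]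
        exact .exch _ _ _ _ _
      | _ => constructor
    · intro p hp
      obtain ⟨q, hq, rfl⟩ := List.mem_map.1 hp
      exact ih q hq

theorem step₁ {s p : Sequent} (hr : Rule true true NoLem s [p]) (h : LJPlus p) : LJPlus s :=
  .step hr (List.forall_mem_singleton.2 h)

theorem step₂ {s p q : Sequent} (hr : Rule true true NoLem s [p, q]) (hp : LJPlus p)
    (hq : LJPlus q) : LJPlus s :=
  .step hr (List.forall_mem_cons.2 ⟨hp, List.forall_mem_singleton.2 hq⟩)

theorem perm {Γ Δ : List Formula} {Λ : Option Formula} (hp : Γ.Perm Δ) (h : LJPlus (Γ, Λ)) :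
    LJPlus (Δ, Λ) := by
  suffices ∀ Θ : List Formula, LJPlus (Θ ++ Γ, Λ) → LJPlus (Θ ++ Δ, Λ) from this [] h
  clear h
  induction hp with
  | nil => exact fun _ h => h
  | cons A _ ih => exact fun Θ h => by simpa using ih (Θ ++ [A]) (by simpa using h)
  | swap A B Γ => exact fun Θ h => step₁ (.exch _ _ _ _ _) h
  | trans _ _ ih₁ ih₂ => exact fun Θ h => ih₂ Θ (ih₁ Θ h)

theorem thin_append (Δ : List Formula) {Γ : List Formula} {Λ : Option Formula}
    (h : LJPlus (Γ, Λ)) : LJPlus (Δ ++ Γ, Λ) := by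
  induction Δ with
  | nil => exact h
  | cons A Δ ih => exact step₁ (.thinL _ _ _) ih

theorem absorb {Γ Δ : List Formula} {Λ : Option Formula} (hs : Γ ⊆ Δ)
    (h : LJPlus (Γ ++ Δ, Λ)) : LJPlus (Δ, Λ) := by
  induction Γ with
  | nil => exact h
  | cons A Γ ih =>
    rw [List.cons_subset] at hs
    refine ih hs.2 ?_
    have hp : (Γ ++ Δ).Perm (A :: (Γ ++ Δ.erase A)) :=
      ((List.perm_cons_erase hs.1).append_left Γ).trans List.perm_middle
    exact perm hp.symm (step₁ (.contr _ _ _) (perm (hp.cons A) h))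

theorem mono {Γ Δ : List Formula} {Λ : Option Formula} (hs : Γ ⊆ Δ) (h : LJPlus (Γ, Λ)) :
    LJPlus (Δ, Λ) :=
  absorb hs (perm List.perm_append_comm (thin_append Δ h))

theorem of_mem {Γ : List Formula} {A : Formula} (h : A ∈ Γ) : LJPlus (Γ, some A) :=
  mono (Γ := [A]) (by simpa using h) (.step (.ax A) (by simp))

theorem cut {Γ : List Formula} {Λ : Option Formula} (C : Formula) (h₁ : LJPlus (Γ, some C))
    (h₂ : LJPlus (C :: Γ, Λ)) : LJPlus (Γ, Λ) :=
  mono (by simp) (step₂ (.cut' Γ Γ C Λ rfl) h₁ h₂)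

theorem imp_elim {Γ : List Formula} {A B : Formula} (h₁ : LJPlus (Γ, some (A.imp B)))
    (h₂ : LJPlus (Γ, some A)) : LJPlus (Γ, some B) :=
  cut _ h₁ (mono (by simp) (step₂ (.impL A B Γ Γ _) h₂ (of_mem (by simp))))

/-- If the formulas `s n` replacing the propositional symbols of a propositional formula `F` are
proved or refuted in `Γ` according to the valuation `v`, then so is the instance of `F`. -/
theorem decide_bindProps {F : Formula} (hF : F.Propositional) {Γ : List Formula}
    {s : ℕ → Formula} {v : ℕ → Bool}
    (ht : ∀ n ∈ F.propSyms, v n = true → LJPlus (Γ, some (s n)))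
    (hf : ∀ n ∈ F.propSyms, v n = false → LJPlus (s n :: Γ, none)) :
    (F.evalP v = true → LJPlus (Γ, some (F.bindProps s))) ∧
      (F.evalP v = false → LJPlus (F.bindProps s :: Γ, none)) := by
  induction F with
  | prop n => exact ⟨ht n (by simp [propSyms, polProps]), hf n (by simp [propSyms, polProps])⟩
  | pred => exact hF.elim
  | all => exact hF.elim
  | ex => exact hF.elim
  | top => exact ⟨fun _ => mono (List.nil_subset _) (.step .topR (by simp)), by simp [evalP]⟩
  | bot =>
    exact ⟨by simp [evalP], fun _ => mono (Γ := [.bot]) (by simp [bindProps])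
      (.step .botL (by simp))⟩
  | neg A ih =>
    obtain ⟨h₁, h₂⟩ := ih hF (propSyms_neg A ▸ ht) (propSyms_neg A ▸ hf)
    simp only [evalP, Bool.not_eq_true', Bool.not_eq_false', bindProps]
    exact ⟨fun h => step₁ (.negR _ _) (h₂ h), fun h => step₁ (.negL _ _) (h₁ h)⟩
  | and A B ihA ihB =>
    rw [propSyms_and] at ht hf
    obtain ⟨a₁, a₂⟩ := ihA hF.1 (fun n hn => ht n (Finset.mem_union_left _ hn))
      (fun n hn => hf n (Finset.mem_union_left _ hn))
    obtain ⟨b₁, b₂⟩ := ihB hF.2 (fun n hn => ht n (Finset.mem_union_right _ hn))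
      (fun n hn => hf n (Finset.mem_union_right _ hn))
    simp only [evalP, Bool.and_eq_true, Bool.and_eq_false_iff, bindProps]
    refine ⟨fun h => step₂ (.andR _ _ _) (a₁ h.1) (b₁ h.2), ?_⟩
    rintro (h | h)
    · exact step₁ (.andL1 _ _ _ _) (a₂ h)
    · exact step₁ (.andL2 _ _ _ _) (b₂ h)
  | or A B ihA ihB =>
    rw [propSyms_or] at ht hf
    obtain ⟨a₁, a₂⟩ := ihA hF.1 (fun n hn => ht n (Finset.mem_union_left _ hn))
      (fun n hn => hf n (Finset.mem_union_left _ hn))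
    obtain ⟨b₁, b₂⟩ := ihB hF.2 (fun n hn => ht n (Finset.mem_union_right _ hn))
      (fun n hn => hf n (Finset.mem_union_right _ hn))
    simp only [evalP, Bool.or_eq_true, Bool.or_eq_false_iff, bindProps]
    refine ⟨?_, fun h => step₂ (.orL _ _ _ _) (a₂ h.1) (b₂ h.2)⟩
    rintro (h | h)
    · exact step₁ (.orR1 _ _ _) (a₁ h)
    · exact step₁ (.orR2 _ _ _) (b₁ h)
  | imp A B ihA ihB =>
    rw [propSyms_imp] at ht hf
    obtain ⟨a₁, a₂⟩ := ihA hF.1 (fun n hn => ht n (Finset.mem_union_left _ hn))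
      (fun n hn => hf n (Finset.mem_union_left _ hn))
    obtain ⟨b₁, b₂⟩ := ihB hF.2 (fun n hn => ht n (Finset.mem_union_right _ hn))
      (fun n hn => hf n (Finset.mem_union_right _ hn))
    simp only [evalP, Bool.or_eq_true, Bool.or_eq_false_iff, Bool.not_eq_true',
      Bool.not_eq_false', bindProps]
    refine ⟨?_, fun h => mono (by simp) (step₂ (.impL _ _ Γ Γ _) (a₁ h.1) (b₂ h.2))⟩
    rintro (h | h)
    · exact step₁ (.impR _ _ _) (step₁ (.thinR _ _) (a₂ h))
    · exact step₁ (.impR _ _ _) (step₁ (.thinL _ _ _) (b₁ h))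

/-- Case distinction on the truth values of finitely many propositional symbols. -/
theorem of_forall_literals (S : Finset ℕ) {Γ : List Formula} {Λ : Option Formula}
    (h : ∀ (v : ℕ → Bool) (Δ : List Formula), Γ ⊆ Δ → (∀ n ∈ S, literal n (v n) ∈ Δ) →
      LJPlus (Δ, Λ)) : LJPlus (Γ, Λ) := by
  induction S using Finset.induction_on generalizing Γ with
  | empty => exact h (fun _ => true) Γ (List.Subset.refl _) (by simp)
  | insert n S hn ih =>
    have key : ∀ b, LJPlus (literal n b :: Γ, Λ) := fun b => by
      refine ih fun v Δ hΔ hS => h (Function.update v n b) Δ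
        (fun A hA => hΔ (List.mem_cons_of_mem _ hA)) fun m hm => ?_
      rcases Finset.mem_insert.1 hm with rfl | hm
      · rw [Function.update_self]
        exact hΔ List.mem_cons_self
      · rw [Function.update_of_ne (ne_of_mem_of_not_mem hm hn)]
        exact hS m hm
    exact step₂ (.neut' (prop n) _ _ rfl trivial) (key true) (key false)

/-- LJ+ derives every classically valid propositional formula. -/
theorem of_classicallyValid {F : Formula} (hF : F.Propositional) (hv : F.ClassicallyValid) :
    LJPlusThm F := by
  refine of_forall_literals F.propSyms fun v Δ _ hS => ?_
  have key := (decide_bindProps hF (Γ := Δ) (s := prop) (v := v) (fun n hn hb => ?_)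
    fun n hn hb => ?_).1 (hv v)
  · rwa [bindProps_prop] at key
  · exact of_mem (by simpa [hb, literal] using hS n hn)
  · have hm : neg (prop n) ∈ Δ := by simpa [hb, literal] using hS n hn
    exact mono (by simpa using hm) (step₁ (.negL (prop n) [prop n]) (of_mem (by simp)))

end LJPlus

/-- if A ⊃ B is a purely predicate formula classically derivable
but not derivable in LJ+, C is a propositional formula derivable in LJ+, and D is
a propositional formula not derivable in LJ+, then neither (A & C) ⊃ B nor
A ⊃ (B ∨ D) is derivable in LJ+. -/
theorem ljplus_no_mixed_weakenings (A B C D : Formula)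
    (hAB : (A.imp B).PurelyPredicate)
    (hLK : LKThm (A.imp B)) (hnot : ¬ LJPlusThm (A.imp B))
    (hC : C.Propositional) (hCd : LJPlusThm C)
    (hD : D.Propositional) (hDn : ¬ LJPlusThm D) :
    ¬ LJPlusThm ((A.and C).imp B) ∧ ¬ LJPlusThm (A.imp (B.or D)) := by
  open LJPlus Formula in
  refine ⟨fun h => hnot ?_, fun h => hDn (of_classicallyValid hD fun v => ?_)⟩
  · exact step₁ (.impR _ _ _) (imp_elim (mono (List.nil_subset _) h)
      (step₂ (.andR _ _ _) (of_mem (by simp)) (mono (List.nil_subset _) hCd)))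
  · by_contra hv
    have hDv := (decide_bindProps hD (Γ := []) (s := fun n => truthConst (v n)) (v := v)
      (fun n _ hb => hb ▸ .step .topR (by simp)) fun n _ hb => hb ▸ .step .botL (by simp)).2
      (by simpa using hv)
    have h' := bindProps_truthConst v h
    simp only [List.map_nil, Option.map_some, bindProps, hAB.1.bindProps_eq,
      hAB.2.bindProps_eq] at h'
    refine hnot (step₁ (.impR _ _ _) (cut _ (imp_elim (mono (List.nil_subset _) h')
      (of_mem (by simp))) (step₂ (.orL _ _ _ _) (of_mem (by simp)) ?_)))
    exact step₁ (.thinR _ _) (mono (by simp) hDv)
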